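/- Let ū be a global minimizer of the convex clustering objective f, and let i, j be indices with ū_i ≠ ū_j. Then ‖c(i) − c(j)‖ − (r(i) + r(j)) > 2λ; that is, the bounding balls of distinct clusters are disjoint and separated by a gap of more than 2λ. -/

import Mathlib

open scoped RealInnerProductSpace Classical

/-- The convex clustering objective:
`f(u) = (1/2)·Σ_i ‖u_i − x_i‖² + λ·Σ_{j<i} ‖u_i − u_j‖`. -/
noncomputable def ccObj {d n : ℕ} (x : Fin n → EuclideanSpace ℝ (Fin d)) (lam : ℝ)
    (u : Fin n → EuclideanSpace ℝ (Fin d)) : ℝ :=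
  (1 / 2) * ∑ i, ‖u i - x i‖ ^ 2 + lam * ∑ i, ∑ j ∈ Finset.Iio i, ‖u i - u j‖

/-- `E_i = Σ_{j : u_j ≠ u_i} (u_i − u_j)/‖u_i − u_j‖`. -/
noncomputable def ccE {d n : ℕ} (u : Fin n → EuclideanSpace ℝ (Fin d)) (i : Fin n) :
    EuclideanSpace ℝ (Fin d) :=
  ∑ j ∈ Finset.univ.filter (fun j => u j ≠ u i), ‖u i - u j‖⁻¹ • (u i - u j)

/-- The cardinality `n(i)` of the cluster of index `i`. -/
noncomputable def ccCard {d n : ℕ} (u : Fin n → EuclideanSpace ℝ (Fin d)) (i : Fin n) : ℕ :=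
  (Finset.univ.filter fun j => u j = u i).card

/-- The bounding-ball center `c(i) = u_i + λ·E_i`. -/
noncomputable def ccCenter {d n : ℕ} (u : Fin n → EuclideanSpace ℝ (Fin d)) (lam : ℝ)
    (i : Fin n) : EuclideanSpace ℝ (Fin d) :=
  u i + lam • ccE u i

/-- The bounding-ball radius `r(i) = λ·(n(i) − 1)`. -/
noncomputable def ccRadius {d n : ℕ} (u : Fin n → EuclideanSpace ℝ (Fin d)) (lam : ℝ)
    (i : Fin n) : ℝ :=
  lam * ((ccCard u i : ℝ) - 1)

/-- The normalization map `v ↦ ‖v‖⁻¹ • v` is monotone. -/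
theorem inner_normalize_sub_nonneg {F : Type*} [NormedAddCommGroup F] [InnerProductSpace ℝ F]
    (a b : F) : 0 ≤ ⟪‖a‖⁻¹ • a - ‖b‖⁻¹ • b, a - b⟫ := by
  have norm_le (v : F) : ‖‖v‖⁻¹ • v‖ ≤ 1 := by
    rw [norm_smul, norm_inv, norm_norm]
    exact inv_mul_le_one
  have inner_self (v : F) : ⟪‖v‖⁻¹ • v, v⟫ = ‖v‖ := by
    rw [real_inner_smul_left, real_inner_self_eq_norm_sq]
    rcases eq_or_ne ‖v‖ 0 with h | h
    · simp [h]
    · field_simp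
  have inner_le (v w : F) : ⟪‖v‖⁻¹ • v, w⟫ ≤ ‖w‖ :=
    (real_inner_le_norm _ _).trans (mul_le_of_le_one_left (norm_nonneg w) (norm_le v))
  rw [inner_sub_left, inner_sub_right, inner_sub_right, inner_self, inner_self]
  linarith [inner_le a b, inner_le b a]

theorem ccE_eq_sum {d n : ℕ} (u : Fin n → EuclideanSpace ℝ (Fin d)) (i : Fin n) :
    ccE u i = ∑ k, ‖u i - u k‖⁻¹ • (u i - u k) := by
  unfold ccE
  refine Finset.sum_subset (Finset.filter_subset _ _) fun k _ hk => ?_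
  have h : u k = u i := by simpa using hk
  simp [h]

theorem ccCard_add_mul_le_inner_ccE_sub {d n : ℕ} (u : Fin n → EuclideanSpace ℝ (Fin d))
    (i j : Fin n) (hij : u i ≠ u j) :
    ((ccCard u i : ℝ) + ccCard u j) * ‖u i - u j‖ ≤ ⟪ccE u i - ccE u j, u i - u j⟫ := by
  have card_eq (l : Fin n) : (ccCard u l : ℝ) = ∑ k, if u k = u l then (1 : ℝ) else 0 := by
    simp [ccCard]
  rw [card_eq, card_eq, ← Finset.sum_add_distrib, Finset.sum_mul, ccE_eq_sum, ccE_eq_sum,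
    ← Finset.sum_sub_distrib, sum_inner]
  have hpos : ‖u i - u j‖ ≠ 0 := norm_ne_zero_iff.mpr (sub_ne_zero.mpr hij)
  have hself : ⟪‖u i - u j‖⁻¹ • (u i - u j), u i - u j⟫ = ‖u i - u j‖ := by
    rw [real_inner_smul_left, real_inner_self_eq_norm_sq]
    field_simp
  refine Finset.sum_le_sum fun k _ => ?_
  by_cases hi : u k = u i
  · have hneg : u j - u i = -(u i - u j) := (neg_sub _ _).symm
    rw [hi, if_pos rfl, if_neg hij, hneg, norm_neg, smul_neg, sub_self, smul_zero, zero_sub,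
      neg_neg, hself]
    simp
  · by_cases hj : u k = u j
    · rw [hj, if_neg hij.symm, if_pos rfl, sub_self, smul_zero, sub_zero, hself]
      simp
    · simpa [hi, hj] using inner_normalize_sub_nonneg (u i - u k) (u j - u k)

/-- The bounding balls of distinct clusters are disjoint, separated by a gap of more
than `2λ`. -/
theorem convex_clustering_ball_gap {d n : ℕ} (hd : 0 < d) (hn : 0 < n)
    (x : Fin n → EuclideanSpace ℝ (Fin d)) (lam : ℝ) (hlam : 0 < lam)
    (ubar : Fin n → EuclideanSpace ℝ (Fin d))
    (hmin : ∀ u : Fin n → EuclideanSpace ℝ (Fin d), ccObj x lam ubar ≤ ccObj x lam u)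
    (i j : Fin n) (hij : ubar i ≠ ubar j) :
    ‖ccCenter ubar lam i - ccCenter ubar lam j‖ - (ccRadius ubar lam i + ccRadius ubar lam j) >
      2 * lam := by
  have hpos : 0 < ‖ubar i - ubar j‖ := norm_pos_iff.mpr (sub_ne_zero.mpr hij)
  have hE := ccCard_add_mul_le_inner_ccE_sub ubar i j hij
  have hsplit : ccCenter ubar lam i - ccCenter ubar lam j =
      (ubar i - ubar j) + lam • (ccE ubar i - ccE ubar j) := by
    simp only [ccCenter, smul_sub]
    abel
  have hcs := real_inner_le_norm (ccCenter ubar lam i - ccCenter ubar lam j) (ubar i - ubar j)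
  have hnorm : ‖ubar i - ubar j‖ + lam * ((ccCard ubar i : ℝ) + ccCard ubar j) ≤
      ‖ccCenter ubar lam i - ccCenter ubar lam j‖ := by
    refine le_of_mul_le_mul_right (le_trans ?_ hcs) hpos
    rw [hsplit, inner_add_left, real_inner_smul_left, real_inner_self_eq_norm_sq]
    linarith [mul_le_mul_of_nonneg_left hE hlam.le]
  unfold ccRadius
  linarith
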